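/- arXiv:2204.01310 — 2 statements merged into one kernel-verified Lean document; each statement's English description precedes it below -/
import Mathlib

section
/- Let (W,S) be a Coxeter system. For w ∈ W, let M(w) = {u ∈ W : u ≤ w in the left weak order and u = w0(J) for some J ⊆ S with W_J finite}. Then the parabolic subgroup generated by the right descent set D_R(w) is finite, and w0(D_R(w)) is the maximum element of M(w); that is, w0(D_R(w)) ∈ M(w) and u ≤ w0(D_R(w)) for every u ∈ M(w). -/
open Polynomial

namespace CoxeterCharPoly

variable {B W : Type*} [Group W] {M : CoxeterMatrix B}

/-- The left weak order on a Coxeter group. -/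
def wle (cs : CoxeterSystem M W) (u w : W) : Prop :=
  cs.length w = cs.length (w * u⁻¹) + cs.length u

/-- The standard parabolic subgroup generated by `J ⊆ S`. -/
def parabolic (cs : CoxeterSystem M W) (J : Set B) : Subgroup W :=
  Subgroup.closure (cs.simple '' J)

/- The longest element of the parabolic subgroup `W_J` (junk value if there is
no element of maximal length). -/
open Classical in
noncomputable def w0 (cs : CoxeterSystem M W) (J : Set B) : W :=
  if h : ∃ w ∈ parabolic cs J, ∀ u ∈ parabolic cs J, cs.length u ≤ cs.length w
  then h.choose else 1

/-- The right descent set of `w`, as a subset of `B`. -/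
def rightDescents (cs : CoxeterSystem M W) (w : W) : Set B :=
  {i | cs.IsRightDescent w i}

/- `μ` is the Möbius function of the subposet `A` of the order `le`. -/
open Classical in
def IsMobiusOn {α : Type*} (le : α → α → Prop) (A : Set α) (μ : α → α → ℤ) : Prop :=
  ∀ a ∈ A, ∀ b ∈ A, le a b →
    (∑ᶠ t ∈ {t | t ∈ A ∧ le a t ∧ le t b}, μ a t) = if a = b then 1 else 0

theorem functionEnd_one_apply {α : Type*} (a : α) : (1 : Function.End α) a = a := rfl

theorem functionEnd_mul_apply {α : Type*} (f g : Function.End α) (a : α) :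
    (f * g) a = f (g a) := rfl

/-- The action of a simple reflection on pairs consisting of a group element and a sign. -/
noncomputable def signedConj (cs : CoxeterSystem M W) (i : B) : Function.End (W × ZMod 2) :=
  open Classical in
  fun p ↦ (cs.simple i * p.1 * cs.simple i, p.2 + if p.1 = cs.simple i then 1 else 0)

open Classical in
theorem signedConj_mul_pow_apply (cs : CoxeterSystem M W) (i j : B) (n : ℕ) (p : W × ZMod 2) :
    ((signedConj cs i * signedConj cs j) ^ n) p =
      ((cs.simple i * cs.simple j) ^ n * p.1 * ((cs.simple i * cs.simple j) ^ n)⁻¹,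
        p.2 + ∑ k ∈ Finset.range (2 * n),
          if p.1 = ((cs.simple i * cs.simple j) ^ k)⁻¹ * cs.simple j then 1 else 0) := by
  set x := cs.simple i * cs.simple j with hx
  have hj : cs.simple j * x = x⁻¹ * cs.simple j := by simp [hx, mul_assoc]
  have hpow (n : ℕ) : cs.simple j * x ^ n = (x ^ n)⁻¹ * cs.simple j := by
    have h : SemiconjBy (cs.simple j) x x⁻¹ := hj
    simpa using (h.pow_right n).eq
  have hconj_even (n : ℕ) (t : W) : x ^ n * t * (x ^ n)⁻¹ = cs.simple j ↔
      t = (x ^ (2 * n))⁻¹ * cs.simple j := by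
    rw [mul_inv_eq_iff_eq_mul, hpow, ← eq_inv_mul_iff_mul_eq, ← mul_assoc, two_mul, pow_add,
      mul_inv_rev]
  have hconj_odd (n : ℕ) (t : W) :
      cs.simple j * (x ^ n * t * (x ^ n)⁻¹) * cs.simple j = cs.simple i ↔
      t = (x ^ (2 * n + 1))⁻¹ * cs.simple j := by
    have : cs.simple j * cs.simple i * cs.simple j = x⁻¹ * cs.simple j := by simp [hx]
    have e : x ^ (2 * n + 1) = x ^ n * x * x ^ n := by
      rw [two_mul, pow_succ, pow_add, mul_assoc, mul_assoc, ← pow_succ, ← pow_succ']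
    have hsimple (y : W) : cs.simple j * y * cs.simple j = cs.simple i ↔
        y = x⁻¹ * cs.simple j := by
      rw [← this]
      constructor
      · intro h
        simp [← h, mul_assoc]
      · rintro rfl
        simp [mul_assoc]
    rw [hsimple, mul_inv_eq_iff_eq_mul, mul_assoc, hpow, ← eq_inv_mul_iff_mul_eq, e]
    simp [mul_assoc]
  induction n with
  | zero => simp [functionEnd_one_apply]
  | succ n ih =>
    rw [pow_succ', functionEnd_mul_apply, ih, functionEnd_mul_apply]
    simp only [signedConj, hconj_even, hconj_odd, mul_add, mul_one, Finset.sum_range_succ,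
      ← add_assoc]
    refine Prod.ext ?_ rfl
    simp [pow_succ', hx, mul_assoc]

theorem isLiftable_signedConj (cs : CoxeterSystem M W) : M.IsLiftable (signedConj cs) := by
  classical
  intro i j
  funext p
  rw [signedConj_mul_pow_apply, cs.simple_mul_simple_pow, two_mul, Finset.sum_range_add]
  simp only [pow_add, cs.simple_mul_simple_pow, one_mul, CharTwo.add_self_eq_zero]
  simp [functionEnd_one_apply]

/-- The action of a Coxeter group on pairs consisting of a group element and a sign. -/
noncomputable def signedConjHom (cs : CoxeterSystem M W) : W →* Function.End (W × ZMod 2) :=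
  cs.lift ⟨signedConj cs, isLiftable_signedConj cs⟩

open Classical in
theorem signedConjHom_wordProd (cs : CoxeterSystem M W) (ω : List B) (p : W × ZMod 2) :
    signedConjHom cs (cs.wordProd ω) p =
      (cs.wordProd ω * p.1 * (cs.wordProd ω)⁻¹, p.2 + (cs.rightInvSeq ω).count p.1) := by
  induction ω with
  | nil => simp [functionEnd_one_apply]
  | cons i ω ih =>
    rw [cs.wordProd_cons, map_mul, functionEnd_mul_apply, ih, signedConjHom, cs.lift_apply_simple]
    have h : cs.wordProd ω * p.1 * (cs.wordProd ω)⁻¹ = cs.simple i ↔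
        (cs.wordProd ω)⁻¹ * cs.simple i * cs.wordProd ω = p.1 := by
      rw [mul_inv_eq_iff_eq_mul, mul_assoc, inv_mul_eq_iff_eq_mul, eq_comm]
    simp [signedConj, CoxeterSystem.rightInvSeq, List.count_cons, add_assoc, h]
    simp only [mul_assoc]

/-- The parity of the number of times `t` occurs in the right inversion sequence of a word
for `w`. -/
noncomputable def invParity (cs : CoxeterSystem M W) (w t : W) : ZMod 2 :=
  (signedConjHom cs w (t, 0)).2

open Classical in
theorem invParity_wordProd (cs : CoxeterSystem M W) (ω : List B) (t : W) :
    invParity cs (cs.wordProd ω) t = (cs.rightInvSeq ω).count t := by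
  simp [invParity, signedConjHom_wordProd]

theorem invParity_mul (cs : CoxeterSystem M W) (u v t : W) :
    invParity cs (u * v) t = invParity cs v t + invParity cs u (v * t * v⁻¹) := by
  classical
  obtain ⟨ω, rfl⟩ := cs.wordProd_surjective u
  obtain ⟨ω', rfl⟩ := cs.wordProd_surjective v
  rw [invParity, map_mul, functionEnd_mul_apply]
  simp [signedConjHom_wordProd, invParity_wordProd]

theorem mem_rightInvSeq_of_invParity_ne_zero (cs : CoxeterSystem M W) {ω : List B} {t : W}
    (h : invParity cs (cs.wordProd ω) t ≠ 0) : t ∈ cs.rightInvSeq ω := by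
  classical
  by_contra ht
  simp [invParity_wordProd, List.count_eq_zero_of_not_mem ht] at h

theorem isRightInversion_of_invParity_ne_zero (cs : CoxeterSystem M W) {w t : W}
    (h : invParity cs w t ≠ 0) : cs.IsRightInversion w t := by
  obtain ⟨ω, hω, rfl⟩ := cs.exists_isReduced w
  exact cs.isRightInversion_of_mem_rightInvSeq hω (mem_rightInvSeq_of_invParity_ne_zero cs h)

theorem invParity_self (cs : CoxeterSystem M W) {t : W} (ht : cs.IsReflection t) :
    invParity cs t t = 1 := by
  classical
  obtain ⟨u, i, rfl⟩ := ht
  have h1 : invParity cs (u * u⁻¹) (u * cs.simple i * u⁻¹) = 0 := by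
    simpa using invParity_wordProd cs [] (u * cs.simple i * u⁻¹)
  have h2 : invParity cs (cs.simple i) (cs.simple i) = 1 := by
    simpa using invParity_wordProd cs [i] (cs.simple i)
  have e : u⁻¹ * (u * cs.simple i * u⁻¹) * u⁻¹⁻¹ = cs.simple i := by group
  rw [invParity_mul, e] at h1
  rw [invParity_mul, e, invParity_mul, h2, cs.inv_simple, cs.simple_mul_simple_self, one_mul,
    add_left_comm, h1, add_zero]

/-- Right inversions are detected by `invParity`. -/
theorem isRightInversion_iff_invParity_ne_zero (cs : CoxeterSystem M W) {w t : W} :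
    cs.IsRightInversion w t ↔ invParity cs w t ≠ 0 := by
  refine ⟨fun h h0 ↦ ?_, isRightInversion_of_invParity_ne_zero cs⟩
  have h1 : invParity cs (w * t) t ≠ 0 := by
    rw [invParity_mul, invParity_self cs h.1, mul_inv_cancel_right, h0]
    decide
  exact h.1.isRightInversion_mul_left_iff.mp (isRightInversion_of_invParity_ne_zero cs h1) h

/-- The strong exchange property. -/
theorem mem_rightInvSeq_of_isRightInversion (cs : CoxeterSystem M W) {ω : List B} {t : W}
    (h : cs.IsRightInversion (cs.wordProd ω) t) : t ∈ cs.rightInvSeq ω :=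
  mem_rightInvSeq_of_invParity_ne_zero cs ((isRightInversion_iff_invParity_ne_zero cs).mp h)

theorem finite_setOf_isRightInversion (cs : CoxeterSystem M W) (w : W) :
    {t | cs.IsRightInversion w t}.Finite := by
  obtain ⟨ω, rfl⟩ := cs.wordProd_surjective w
  exact (cs.rightInvSeq ω).finite_toSet.subset fun t ht ↦
    mem_rightInvSeq_of_isRightInversion cs ht

/-- An element of a Coxeter group is determined by its set of right inversions. -/
theorem setOf_isRightInversion_injective (cs : CoxeterSystem M W) :
    Function.Injective fun w ↦ {t | cs.IsRightInversion w t} := by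
  intro v w h
  have key (t : W) : invParity cs v t = invParity cs w t := by
    have ht : t ∈ {t | cs.IsRightInversion v t} ↔ t ∈ {t | cs.IsRightInversion w t} :=
      Set.ext_iff.mp h t
    simp only [Set.mem_ofPred_eq, isRightInversion_iff_invParity_ne_zero] at ht
    generalize invParity cs v t = a at ht ⊢
    generalize invParity cs w t = b at ht ⊢
    revert a b
    decide
  have hzero (t : W) : invParity cs (v * w⁻¹) t = 0 := by
    have h1 := invParity_mul cs (v * w⁻¹) w (w⁻¹ * t * w)
    rw [inv_mul_cancel_right, key, left_eq_add] at h1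
    rwa [show w * (w⁻¹ * t * w) * w⁻¹ = t by group] at h1
  by_contra hne
  obtain ⟨i, hi⟩ := cs.exists_rightDescent_of_ne_one (mt mul_inv_eq_one.mp hne)
  exact (isRightInversion_iff_invParity_ne_zero cs).mp
    ((cs.isRightInversion_simple_iff_isRightDescent _ i).mpr hi) (hzero _)

theorem wle_of_mul_simple (cs : CoxeterSystem M W) {v w : W} {i : B} (hvw : wle cs v w)
    (hv : cs.length v < cs.length (v * cs.simple i)) (hw : cs.IsRightDescent w i) :
    wle cs (v * cs.simple i) w := by
  have hparity := invParity_mul cs (w * v⁻¹) v (cs.simple i)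
  rw [inv_mul_cancel_right] at hparity
  have hw' := (isRightInversion_iff_invParity_ne_zero cs).mp
    ((cs.isRightInversion_simple_iff_isRightDescent w i).mpr hw)
  have hv0 : invParity cs v (cs.simple i) = 0 := by
    by_contra h
    exact hv.not_gt (isRightInversion_of_invParity_ne_zero cs h).2
  rw [hparity, hv0, zero_add] at hw'
  have hlt := (isRightInversion_of_invParity_ne_zero cs hw').2
  have e : w * v⁻¹ * (v * cs.simple i * v⁻¹) = w * (v * cs.simple i)⁻¹ := by
    simp [mul_assoc]
  rw [e] at hlt
  have h1 := cs.length_mul_le (w * (v * cs.simple i)⁻¹) (v * cs.simple i)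
  rw [inv_mul_cancel_right] at h1
  have h2 := cs.length_mul_simple v i
  simp only [wle] at hvw ⊢
  lia

theorem isRightInversion_of_wle (cs : CoxeterSystem M W) {v w t : W} (hvw : wle cs v w)
    (ht : cs.IsRightInversion v t) : cs.IsRightInversion w t := by
  refine ⟨ht.1, ?_⟩
  have h1 := cs.length_mul_le (w * v⁻¹) (v * t)
  rw [← mul_assoc, inv_mul_cancel_right] at h1
  have h2 := ht.2
  simp only [wle] at hvw
  lia

theorem finite_setOf_wle (cs : CoxeterSystem M W) (w : W) : {v | wle cs v w}.Finite :=
  ((finite_setOf_isRightInversion cs w).finite_subsets.preimage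
    (setOf_isRightInversion_injective cs).injOn).subset fun _ hv _ ht ↦
      isRightInversion_of_wle cs hv ht

theorem simple_mem_parabolic (cs : CoxeterSystem M W) {J : Set B} {i : B} (hi : i ∈ J) :
    cs.simple i ∈ parabolic cs J :=
  Subgroup.subset_closure (Set.mem_image_of_mem _ hi)

/-- Every element of a standard parabolic subgroup has a reduced word in its generators. -/
theorem exists_isReduced_of_mem_parabolic (cs : CoxeterSystem M W) {J : Set B} {v : W}
    (hv : v ∈ parabolic cs J) :
    ∃ ω : List B, cs.IsReduced ω ∧ (∀ i ∈ ω, i ∈ J) ∧ v = cs.wordProd ω := by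
  have step (v : W) (i : B) (hi : i ∈ J)
      (h : ∃ ω : List B, cs.IsReduced ω ∧ (∀ i ∈ ω, i ∈ J) ∧ v = cs.wordProd ω) :
      ∃ ω : List B, cs.IsReduced ω ∧ (∀ i ∈ ω, i ∈ J) ∧ v * cs.simple i = cs.wordProd ω := by
    obtain ⟨ω, hω, hJ, rfl⟩ := h
    rcases cs.length_mul_simple (cs.wordProd ω) i with h | h
    · refine ⟨ω ++ [i], ?_, ?_, ?_⟩
      · simp [CoxeterSystem.IsReduced, cs.wordProd_append, h, hω.eq]
      · simp only [List.mem_append, List.mem_singleton]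
        rintro k (hk | rfl)
        exacts [hJ k hk, hi]
      · simp [cs.wordProd_append]
    · have hmem := mem_rightInvSeq_of_isRightInversion cs
        ((cs.isRightInversion_simple_iff_isRightDescent (cs.wordProd ω) i).mpr
          (cs.isRightDescent_iff.mpr h))
      obtain ⟨k, hk, hki⟩ := List.mem_iff_getElem.mp hmem
      have hprod : cs.wordProd ω * cs.simple i = cs.wordProd (ω.eraseIdx k) := by
        rw [← hki, ← List.getD_eq_getElem _ 1 hk, cs.wordProd_mul_getD_rightInvSeq]
      rw [cs.length_rightInvSeq] at hk
      refine ⟨ω.eraseIdx k, ?_, fun j hj ↦ hJ j (List.mem_of_mem_eraseIdx hj), hprod⟩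
      have := List.length_eraseIdx_add_one hk
      have := hω.eq
      rw [CoxeterSystem.IsReduced, ← hprod]
      lia
  induction hv using Subgroup.closure_induction_right with
  | one => exact ⟨[], by simp [CoxeterSystem.IsReduced], by simp, by simp⟩
  | mul_right x _ y hy ih =>
    obtain ⟨i, hi, rfl⟩ := hy
    exact step x i hi ih
  | mul_inv_cancel x _ y hy ih =>
    obtain ⟨i, hi, rfl⟩ := hy
    rw [cs.inv_simple]
    exact step x i hi ih

/-- An element having every `i ∈ J` as a right descent dominates the parabolic subgroup
generated by `J`. -/
theorem wle_of_mem_parabolic (cs : CoxeterSystem M W) {J : Set B} {v w : W}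
    (hw : ∀ i ∈ J, cs.IsRightDescent w i) (hv : v ∈ parabolic cs J) : wle cs v w := by
  obtain ⟨ω, hω, hJ, rfl⟩ := exists_isReduced_of_mem_parabolic cs hv
  clear hv
  induction ω using List.reverseRecOn with
  | nil => simp [wle]
  | append_singleton ω i ih =>
    have hω' : cs.IsReduced ω := by simpa using hω.take ω.length
    have hlen := hω.eq
    rw [cs.wordProd_append, cs.wordProd_singleton] at hlen ⊢
    refine wle_of_mul_simple cs (ih hω' fun j hj ↦ hJ j (by simp [hj])) ?_ (hw i (hJ i (by simp)))
    rw [hlen, hω'.eq]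
    simp

theorem w0_spec (cs : CoxeterSystem M W) {J : Set B} (hJ : (parabolic cs J : Set W).Finite) :
    w0 cs J ∈ parabolic cs J ∧ ∀ u ∈ parabolic cs J, cs.length u ≤ cs.length (w0 cs J) := by
  have h : ∃ w ∈ parabolic cs J, ∀ u ∈ parabolic cs J, cs.length u ≤ cs.length w :=
    Set.exists_max_image _ cs.length hJ ⟨1, one_mem _⟩
  rw [w0, dif_pos h]
  exact h.choose_spec

theorem isRightDescent_w0 (cs : CoxeterSystem M W) {J : Set B}
    (hJ : (parabolic cs J : Set W).Finite) {i : B} (hi : i ∈ J) :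
    cs.IsRightDescent (w0 cs J) i :=
  lt_of_le_of_ne
    ((w0_spec cs hJ).2 _ (mul_mem (w0_spec cs hJ).1 (simple_mem_parabolic cs hi)))
    (cs.length_mul_simple_ne _ i)

/-- `W_{D_R(w)}` is finite and `w0(D_R(w))` is the maximum of the set
`M(w)` of elements `u ≤ w` that are longest elements of finite parabolic subgroups. -/
theorem w0_descents_is_max (cs : CoxeterSystem M W) (w : W) :
    (parabolic cs (rightDescents cs w) : Set W).Finite ∧
    w0 cs (rightDescents cs w) ∈
      {u : W | wle cs u w ∧ ∃ J : Set B, (parabolic cs J : Set W).Finite ∧ u = w0 cs J} ∧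
    ∀ u ∈ {u : W | wle cs u w ∧
        ∃ J : Set B, (parabolic cs J : Set W).Finite ∧ u = w0 cs J},
      wle cs u (w0 cs (rightDescents cs w)) := by
  have hfin : (parabolic cs (rightDescents cs w) : Set W).Finite :=
    (finite_setOf_wle cs w).subset fun v hv ↦ wle_of_mem_parabolic cs (fun i hi ↦ hi) hv
  refine ⟨hfin, ⟨wle_of_mem_parabolic cs (fun i hi ↦ hi) (w0_spec cs hfin).1, _, hfin, rfl⟩, ?_⟩
  rintro _ ⟨huw, K, hK, rfl⟩
  have hKw : K ⊆ rightDescents cs w := fun i hi ↦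
    (cs.isRightInversion_simple_iff_isRightDescent w i).mp <| isRightInversion_of_wle cs huw <|
      (cs.isRightInversion_simple_iff_isRightDescent _ i).mpr (isRightDescent_w0 cs hK hi)
  exact wle_of_mem_parabolic cs (fun i hi ↦ isRightDescent_w0 cs hfin (hKw hi)) (w0_spec cs hK).1

end CoxeterCharPoly
end

section
/- For n ≥ 1, let (B_n, S) be the Coxeter system with S = {s_1,…,s_n}, m(s_i,s_{i+1}) = 3 for 1 ≤ i ≤ n−2, m(s_{n−1},s_n) = 4 (when n ≥ 2), and m(s_i,s_j) = 2 for |i−j| ≥ 2. Let B_{n,k,l} be the number of subsets J ⊆ S with |J| = k and ℓ(w0(J)) = l, and set B_{0,k,l} = 1 if k = l = 0 and B_{0,k,l} = 0 otherwise. Let T_B(x,y,z) = Σ_{n≥0} Σ_{k≥0} Σ_{l≥0} B_{n,k,l} x^n y^k z^l, P = Σ_{n≥0} x^n y^n z^{C(n+1,2)}, and Q = Σ_{n≥0} x^n y^n z^{n²}, regarded as formal power series in x whose coefficients are polynomials in y and z. Then T_B(x,y,z) · (1 − x·P) = Q. -/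
open Polynomial

namespace CoxeterCharPoly

variable {B W : Type*} [Group W] {M : CoxeterMatrix B}

/-- The length of the longest element of the standard parabolic subgroup `W_J` of the
Coxeter group of type `Bₙ`. -/
noncomputable def lenB (n : ℕ) (J : Finset (Fin n)) : ℕ :=
  (CoxeterMatrix.Bₙ n).toCoxeterSystem.length
    (w0 (CoxeterMatrix.Bₙ n).toCoxeterSystem (↑J : Set (Fin n)))

/-- `B_{n,k,l}`: the number of subsets `J ⊆ S` with `|J| = k` and `ℓ(w0(J)) = l`
in the Coxeter system of type `Bₙ`. (For `n = 0` this is `1` if `k = l = 0`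
and `0` otherwise.) -/
noncomputable def Bcount (n k l : ℕ) : ℕ :=
  Nat.card {J : Finset (Fin n) // J.card = k ∧ lenB n J = l}

/-- The variable `y`, in the ring of polynomials in `y` and `z` over `ℤ`. -/
noncomputable def yv : Polynomial (Polynomial ℤ) := Polynomial.C Polynomial.X

/-- The variable `z`, in the ring of polynomials in `y` and `z` over `ℤ`. -/
noncomputable def zv : Polynomial (Polynomial ℤ) := Polynomial.X

/-- `T_B(x,y,z) = Σ_{n,k,l ≥ 0} B_{n,k,l} x^n y^k z^l`, as a formal power series in `x`
whose coefficients are polynomials in `y` and `z`. -/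
noncomputable def TB : PowerSeries (Polynomial (Polynomial ℤ)) :=
  PowerSeries.mk fun n =>
    ∑ᶠ (k : ℕ), ∑ᶠ (l : ℕ), (Bcount n k l : Polynomial (Polynomial ℤ)) * yv ^ k * zv ^ l

/-- `P = Σ_{n ≥ 0} x^n y^n z^(C(n+1,2))`. -/
noncomputable def Pser : PowerSeries (Polynomial (Polynomial ℤ)) :=
  PowerSeries.mk fun n => yv ^ n * zv ^ ((n + 1).choose 2)

/-- `Q = Σ_{n ≥ 0} x^n y^n z^(n²)`. -/
noncomputable def Qser : PowerSeries (Polynomial (Polynomial ℤ)) :=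
  PowerSeries.mk fun n => yv ^ n * zv ^ (n ^ 2)

set_option linter.deprecated false

section Words

variable {G : Type*} [Group G]

/-- The relations satisfied by the simple reflections `s 0, …, s N` of type `B_{N+1}`. -/
structure IsTypeB (s : ℕ → G) (N : ℕ) : Prop where
  sq (i : ℕ) : s i * s i = 1
  comm {i j : ℕ} : i + 1 < j → s i * s j = s j * s i
  braid {i : ℕ} : i + 1 < N → s i * s (i + 1) * s i = s (i + 1) * s i * s (i + 1)
  braid_last {i : ℕ} : i + 1 = N →
    s i * s (i + 1) * s i * s (i + 1) = s (i + 1) * s i * s (i + 1) * s i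

/-- The product `s j * s (j + 1) * ⋯ * s (j + k - 1)`. -/
def ascProd (s : ℕ → G) (j : ℕ) : ℕ → G
  | 0 => 1
  | k + 1 => ascProd s j k * s (j + k)

/-- The product `s j * ⋯ * s N * s (N - 1) * ⋯ * s (N - d)`. -/
def turnProd (s : ℕ → G) (N j : ℕ) : ℕ → G
  | 0 => ascProd s j (N + 1 - j)
  | d + 1 => turnProd s N j d * s (N - 1 - d)

namespace IsTypeB

variable {s : ℕ → G} {N : ℕ}

theorem mul_sq (hs : IsTypeB s N) (g : G) (i : ℕ) : g * s i * s i = g := by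
  rw [mul_assoc, hs.sq, mul_one]

theorem ascProd_mul_of_gt (hs : IsTypeB s N) {i j k : ℕ} (h : j + k < i) :
    ascProd s j k * s i = s i * ascProd s j k := by
  induction k with
  | zero => simp [ascProd]
  | succ k ih =>
    rw [ascProd, mul_assoc, hs.comm (by omega), ← mul_assoc, ih (by omega), mul_assoc]

theorem ascProd_mul_of_lt (hs : IsTypeB s N) {i j k : ℕ} (hj : j ≤ i) (hk : i + 1 < j + k)
    (hN : i + 1 < N) : ascProd s j k * s i = s (i + 1) * ascProd s j k := by
  induction k with
  | zero => omega
  | succ k ih =>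
    rcases Nat.lt_or_ge (i + 1) (j + k) with h | h
    · rw [ascProd, mul_assoc, ← hs.comm h, ← mul_assoc, ih h, mul_assoc]
    · obtain ⟨k, rfl⟩ : ∃ k', k = k' + 1 := ⟨k - 1, by omega⟩
      obtain rfl : i = j + k := by omega
      have h1 := hs.ascProd_mul_of_gt (i := j + k + 1) (j := j) (k := k) (by omega)
      have h2 := hs.braid hN
      calc ascProd s j (k + 1 + 1) * s (j + k)
          = ascProd s j k * (s (j + k) * s (j + k + 1) * s (j + k)) := by
            simp only [ascProd, mul_assoc, add_assoc]
        _ = ascProd s j k * s (j + k + 1) * s (j + k) * s (j + k + 1) := by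
            rw [h2]; simp only [mul_assoc]
        _ = s (j + k + 1) * ascProd s j (k + 1 + 1) := by
            rw [h1]; simp only [ascProd, mul_assoc, add_assoc]

theorem turnProd_mul_of_lt (hs : IsTypeB s N) {j d t : ℕ} (hj : j ≤ t) (h : t + d + 1 < N) :
    turnProd s N j d * s t = s (t + 1) * turnProd s N j d := by
  induction d with
  | zero => exact hs.ascProd_mul_of_lt hj (by omega) (by omega)
  | succ d ih =>
    rw [turnProd, mul_assoc, ← hs.comm (by omega), ← mul_assoc, ih (by omega), mul_assoc]

theorem turnProd_mul_of_gt (hs : IsTypeB s N) {j d t : ℕ} (hd : j + d ≤ N) (h : N < t + d)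
    (ht : t ≤ N) : turnProd s N j d * s t = s t * turnProd s N j d := by
  induction d with
  | zero => omega
  | succ d ih =>
    rcases Nat.lt_or_ge N (t + d) with h' | h'
    · rw [turnProd, mul_assoc, hs.comm (by omega), ← mul_assoc, ih (by omega) h', mul_assoc]
    obtain rfl : N = t + d := by omega
    obtain ⟨u, rfl⟩ : ∃ u, t = u + 1 := ⟨t - 1, by omega⟩
    rcases d with _ | d
    · obtain ⟨k, rfl⟩ : ∃ k, u = j + k := ⟨u - j, by omega⟩
      have h1 := hs.ascProd_mul_of_gt (i := j + k + 1) (j := j) (k := k) (by omega)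
      have h2 := hs.braid_last (i := j + k) (by omega)
      have h3 : turnProd s (j + k + 1 + 0) j (0 + 1) =
          ascProd s j k * s (j + k) * s (j + k + 1) * s (j + k) := by
        simp only [turnProd, show j + k + 1 + 0 + 1 - j = k + 1 + 1 by omega,
          show j + k + 1 + 0 - 1 - 0 = j + k by omega, ascProd, ← add_assoc]
      calc turnProd s (j + k + 1 + 0) j (0 + 1) * s (j + k + 1)
          = ascProd s j k * (s (j + k) * s (j + k + 1) * s (j + k) * s (j + k + 1)) := by
            rw [h3]; simp only [mul_assoc]
        _ = ascProd s j k * s (j + k + 1) * s (j + k) * s (j + k + 1) * s (j + k) := by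
            rw [h2]; simp only [mul_assoc]
        _ = s (j + k + 1) * turnProd s (j + k + 1 + 0) j (0 + 1) := by
            rw [h1, h3]; simp only [mul_assoc]
    · have h1 := hs.turnProd_mul_of_lt (j := j) (d := d) (t := u) (by omega) (by omega)
      have h2 := hs.braid (i := u) (by omega)
      have h3 : u + 1 + (d + 1) - 1 - d = u + 1 := by omega
      have h4 : u + 1 + (d + 1) - 1 - (d + 1) = u := by omega
      calc turnProd s (u + 1 + (d + 1)) j (d + 1 + 1) * s (u + 1)
          = turnProd s (u + 1 + (d + 1)) j d * (s (u + 1) * s u * s (u + 1)) := by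
            simp only [turnProd, h3, h4, mul_assoc]
        _ = turnProd s (u + 1 + (d + 1)) j d * s u * s (u + 1) * s u := by
            rw [← h2]; simp only [mul_assoc]
        _ = s (u + 1) * turnProd s (u + 1 + (d + 1)) j (d + 1 + 1) := by
            rw [h1]; simp only [turnProd, h3, h4, mul_assoc]

end IsTypeB

/-- If right multiplication by the generating involutions in `T` permutes the cosets `H * r`
with `r ∈ R`, and `1 ∈ R`, then these cosets cover the subgroup generated by `T`. -/
theorem exists_mul_eq_of_mem_closure {H : Subgroup G} {T R : Set G} (hT : ∀ t ∈ T, t * t = 1)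
    (h1 : (1 : G) ∈ R) (hR : ∀ r ∈ R, ∀ t ∈ T, ∃ h ∈ H, ∃ r' ∈ R, r * t = h * r')
    {w : G} (hw : w ∈ Subgroup.closure T) : ∃ h ∈ H, ∃ r ∈ R, w = h * r := by
  induction hw using Subgroup.closure_induction_right with
  | one => exact ⟨1, H.one_mem, 1, h1, by simp⟩
  | mul_right x hx t ht ih =>
    obtain ⟨h, hh, r, hr, rfl⟩ := ih
    obtain ⟨h', hh', r', hr', e⟩ := hR r hr t ht
    exact ⟨h * h', H.mul_mem hh hh', r', hr', by rw [mul_assoc, e, mul_assoc]⟩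
  | mul_inv_cancel x hx t ht ih =>
    obtain ⟨h, hh, r, hr, rfl⟩ := ih
    obtain ⟨h', hh', r', hr', e⟩ := hR r hr t ht
    refine ⟨h * h', H.mul_mem hh hh', r', hr', ?_⟩
    rw [inv_eq_of_mul_eq_one_left (hT t ht), mul_assoc, e, mul_assoc]

/-- The subgroup generated by the `s (j + i)` such that the `i`-th entry of `l` is `true`. -/
def listSubgroup (s : ℕ → G) (j : ℕ) (l : List Bool) : Subgroup G :=
  Subgroup.closure {g | ∃ i, l[i]? = some true ∧ g = s (j + i)}

theorem mem_listSubgroup (s : ℕ → G) (j : ℕ) {l : List Bool} {i : ℕ} (h : l[i]? = some true) :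
    s (j + i) ∈ listSubgroup s j l :=
  Subgroup.subset_closure ⟨i, h, rfl⟩

theorem listSubgroup_nil (s : ℕ → G) (j : ℕ) : listSubgroup s j [] = ⊥ := by
  simp [listSubgroup]

theorem listSubgroup_false_cons (s : ℕ → G) (j : ℕ) (l : List Bool) :
    listSubgroup s j (false :: l) = listSubgroup s (j + 1) l := by
  unfold listSubgroup
  congr 1
  ext g
  constructor
  · rintro ⟨_ | i, h, rfl⟩
    · simp at h
    · exact ⟨i, by simpa using h, by congr 1; omega⟩
  · rintro ⟨i, h, rfl⟩
    exact ⟨i + 1, by simpa using h, by congr 1; omega⟩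

theorem listSubgroup_le_cons (s : ℕ → G) (j : ℕ) (b : Bool) (l : List Bool) :
    listSubgroup s (j + 1) l ≤ listSubgroup s j (b :: l) := by
  refine Subgroup.closure_mono ?_
  rintro _ ⟨i, h, rfl⟩
  exact ⟨i + 1, by simpa using h, by congr 1; omega⟩

/-- The number of leading entries `true` of a list. -/
def blockLen : List Bool → ℕ
  | [] => 0
  | false :: _ => 0
  | true :: l => blockLen l + 1

/-- The maximal length of a minimal coset representative when the first entry of `l` is added
to the set of generators described by the remaining entries. -/
def cosetLen (l : List Bool) : ℕ :=
  if blockLen l = l.length then 2 * blockLen l - 1 else blockLen l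

/-- The length of the longest element of the parabolic subgroup of the Coxeter group of type `Bₙ`
whose generators are given by the list `l` of length `n`. -/
def longestLen : List Bool → ℕ
  | [] => 0
  | b :: l => longestLen l + cosetLen (b :: l)

theorem cosetLen_false_cons (l : List Bool) : cosetLen (false :: l) = 0 := by
  simp [cosetLen, blockLen]

theorem blockLen_le (l : List Bool) : blockLen l ≤ l.length := by
  induction l with
  | nil => simp [blockLen]
  | cons b l ih => cases b <;> simp [blockLen, ih]

theorem getElem?_of_lt_blockLen {l : List Bool} {i : ℕ} (h : i < blockLen l) :
    l[i]? = some true := by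
  induction l generalizing i with
  | nil => simp [blockLen] at h
  | cons b l ih =>
    cases b
    · simp [blockLen] at h
    · cases i with
      | zero => simp
      | succ i => simpa using ih (by simpa [blockLen] using h)

theorem getElem?_blockLen_ne (l : List Bool) : l[blockLen l]? ≠ some true := by
  induction l with
  | nil => simp
  | cons b l ih => cases b <;> simp [blockLen, ih]

/-- Representatives of the right cosets of `listSubgroup s (j + 1) l` in
`listSubgroup s j (true :: l)`. -/
theorem IsTypeB.exists_coset_rep {s : ℕ → G} {N : ℕ} (hs : IsTypeB s N) {j : ℕ} {l : List Bool}
    (hj : j + l.length = N) {w : G} (hw : w ∈ listSubgroup s j (true :: l)) :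
    ∃ h ∈ listSubgroup s (j + 1) l, ∃ r, w = h * r ∧
      ((∃ k ≤ cosetLen (true :: l), r = ascProd s j k) ∨
        ∃ d, N + 1 - j + d ≤ cosetLen (true :: l) ∧ r = turnProd s N j d) := by
  set m := blockLen (true :: l) with hm
  have hmem {i : ℕ} (h0 : 0 < i) (h : (true :: l)[i]? = some true) :
      s (j + i) ∈ listSubgroup s (j + 1) l := by
    obtain ⟨i, rfl⟩ : ∃ i', i = i' + 1 := ⟨i - 1, by omega⟩
    rw [show j + (i + 1) = j + 1 + i by omega]
    exact mem_listSubgroup s _ (by simpa using h)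
  have hm0 : 0 < m := by simp [hm, blockLen]
  have hml : m ≤ l.length + 1 := by simpa using blockLen_le (true :: l)
  have hlt {i : ℕ} (h : i < m) : (true :: l)[i]? = some true := getElem?_of_lt_blockLen h
  have hne : (true :: l)[m]? ≠ some true := getElem?_blockLen_ne _
  have hasc {i k : ℕ} (hi : (true :: l)[i]? = some true) (hk : k ≤ m) (hkN : j + k ≤ N) :
      ∃ h ∈ listSubgroup s (j + 1) l, ∃ k' ≤ m, ascProd s j k * s (j + i) = h * ascProd s j k' := by
    rcases lt_trichotomy i k with h | rfl | h
    · rcases Nat.lt_or_ge (i + 1) k with h' | h'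
      · exact ⟨s (j + (i + 1)), hmem (by omega) (hlt (by omega)), k, hk,
          hs.ascProd_mul_of_lt (by omega) (by omega) (by omega)⟩
      · obtain rfl : k = i + 1 := by omega
        exact ⟨1, one_mem _, i, by omega, by rw [ascProd, hs.mul_sq, one_mul]⟩
    · have : i ≠ m := fun h => hne (h ▸ hi)
      exact ⟨1, one_mem _, i + 1, by omega, by rw [ascProd, one_mul]⟩
    · exact ⟨s (j + i), hmem (by omega) hi, k, hk, hs.ascProd_mul_of_gt (by omega)⟩
  have hcl (R : Set G) (h1 : (1 : G) ∈ R) (hR : ∀ r ∈ R, ∀ i, (true :: l)[i]? = some true →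
      ∃ h ∈ listSubgroup s (j + 1) l, ∃ r' ∈ R, r * s (j + i) = h * r') :
      ∃ h ∈ listSubgroup s (j + 1) l, ∃ r ∈ R, w = h * r := by
    refine exists_mul_eq_of_mem_closure ?_ h1 ?_ hw
    · rintro _ ⟨i, -, rfl⟩
      exact hs.sq _
    · rintro r hr _ ⟨i, hi, rfl⟩
      exact hR r hr i hi
  by_cases hfull : m = l.length + 1
  · have hc : cosetLen (true :: l) = 2 * m - 1 := by
      rw [cosetLen, ← hm, if_pos (by simpa using hfull)]
    rw [hc]
    have hturn {i d : ℕ} (hi : i < m) (hd : j + d ≤ N) : ∃ h ∈ listSubgroup s (j + 1) l,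
        ∃ r' ∈ {r | ∃ k ≤ m, r = ascProd s j k} ∪ {r | ∃ d, j + d ≤ N ∧ r = turnProd s N j d},
        turnProd s N j d * s (j + i) = h * r' := by
      rcases Nat.lt_or_ge N (j + i + d) with h | h
      · exact ⟨_, hmem (by omega) (hlt hi), _, Or.inr ⟨d, hd, rfl⟩,
          hs.turnProd_mul_of_gt hd h (by omega)⟩
      rcases Nat.lt_or_ge (j + i + d + 1) N with h' | h'
      · exact ⟨s (j + (i + 1)), hmem (by omega) (hlt (by omega)), _, Or.inr ⟨d, hd, rfl⟩,
          hs.turnProd_mul_of_lt (by omega) (by omega)⟩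
      rcases Nat.lt_or_ge (j + i + d) N with h'' | h''
      · exact ⟨1, one_mem _, _, Or.inr ⟨d + 1, by omega, rfl⟩, by
          rw [turnProd, one_mul, show N - 1 - d = j + i by omega]⟩
      rcases d with _ | d
      · refine ⟨1, one_mem _, _, Or.inl ⟨i, by omega, rfl⟩, ?_⟩
        rw [turnProd, one_mul, show N + 1 - j = i + 1 by omega, ascProd, hs.mul_sq]
      · refine ⟨1, one_mem _, _, Or.inr ⟨d, by omega, rfl⟩, ?_⟩
        rw [turnProd, one_mul, show N - 1 - d = j + i by omega, hs.mul_sq]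
    obtain ⟨h, hh, r, hr, e⟩ := hcl ({r | ∃ k ≤ m, r = ascProd s j k} ∪
        {r | ∃ d, j + d ≤ N ∧ r = turnProd s N j d}) (Or.inl ⟨0, by omega, rfl⟩) (by
      rintro r (⟨k, hk, rfl⟩ | ⟨d, hd, rfl⟩) i hi
      · rcases hk.eq_or_lt with rfl | hk'
        · have := hturn (i := i) (d := 0) ?_ (by omega)
          · rwa [turnProd, show N + 1 - j = m by omega] at this
          · have := (List.getElem?_eq_some_iff.mp hi).1
            simp only [List.length_cons] at this
            omega
        · obtain ⟨h, hh, k', hk', e⟩ := hasc hi hk (by omega)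
          exact ⟨h, hh, _, Or.inl ⟨k', hk', rfl⟩, e⟩
      · refine hturn ?_ hd
        have := (List.getElem?_eq_some_iff.mp hi).1
        simp only [List.length_cons] at this
        omega)
    refine ⟨h, hh, r, e, hr.imp ?_ ?_⟩
    · exact fun ⟨k, hk, e⟩ => ⟨k, by omega, e⟩
    · exact fun ⟨d, hd, e⟩ => ⟨d, by omega, e⟩
  · have hc : cosetLen (true :: l) = m := by
      rw [cosetLen, ← hm, if_neg (by simpa using hfull)]
    rw [hc]
    obtain ⟨h, hh, r, ⟨k, hk, rfl⟩, e⟩ := hcl {r | ∃ k ≤ m, r = ascProd s j k}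
      ⟨0, by omega, rfl⟩ (by
        rintro _ ⟨k, hk, rfl⟩ i hi
        obtain ⟨h, hh, k', hk', e⟩ := hasc hi hk (by omega)
        exact ⟨h, hh, _, ⟨k', hk', rfl⟩, e⟩)
    exact ⟨h, hh, _, e, Or.inl ⟨k, hk, rfl⟩⟩

end Words

section UpperBound

variable (cs : CoxeterSystem M W) {s : ℕ → W} {N : ℕ}

theorem length_ascProd_le (hl : ∀ i, cs.length (s i) ≤ 1) (j k : ℕ) :
    cs.length (ascProd s j k) ≤ k := by
  induction k with
  | zero => simp [ascProd]
  | succ k ih => exact (cs.length_mul_le _ _).trans (add_le_add ih (hl _))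

theorem length_turnProd_le (hl : ∀ i, cs.length (s i) ≤ 1) (j d : ℕ) :
    cs.length (turnProd s N j d) ≤ N + 1 - j + d := by
  induction d with
  | zero => exact length_ascProd_le cs hl _ _
  | succ d ih =>
    exact (cs.length_mul_le _ _).trans ((add_le_add ih (hl _)).trans (add_assoc _ _ _).le)

theorem length_le_longestLen (hs : IsTypeB s N) (hl : ∀ i, cs.length (s i) ≤ 1) {j : ℕ}
    {l : List Bool} (hj : j + l.length = N + 1) {w : W} (hw : w ∈ listSubgroup s j l) :
    cs.length w ≤ longestLen l := by
  induction l generalizing j w with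
  | nil =>
    rw [listSubgroup_nil, Subgroup.mem_bot] at hw
    simp [hw]
  | cons b l ih =>
    rw [List.length_cons] at hj
    cases b with
    | false =>
      rw [listSubgroup_false_cons] at hw
      exact (ih (by omega) hw).trans (Nat.le_add_right _ _)
    | true =>
      obtain ⟨h, hh, r, rfl, hr⟩ := hs.exists_coset_rep (by omega) hw
      refine (cs.length_mul_le _ _).trans (add_le_add (ih (by omega) hh) ?_)
      rcases hr with ⟨k, hk, rfl⟩ | ⟨d, hd, rfl⟩
      · exact (length_ascProd_le cs hl j k).trans hk
      · exact (length_turnProd_le cs hl j d).trans hd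

end UpperBound

section LowerBound

/-- The action of the `i`-th simple reflection of type `Bₙ` on integer sequences: it exchanges the
entries `i` and `i + 1` if `i + 1 < n`, and negates the entry `n - 1` if `i + 1 = n`. -/
def reflect (n i : ℕ) (v : ℕ → ℤ) : ℕ → ℤ :=
  if i + 1 < n then v ∘ Equiv.swap i (i + 1) else Function.update v i (-v i)

/-- The number of positive roots `e_a - e_b`, `e_a + e_b` which are negative on `v`. -/
def pairInv (v : ℕ → ℤ) (p : ℕ × ℕ) : ℤ :=
  if p.1 < p.2 then (if v p.1 < v p.2 then 1 else 0) + if v p.1 + v p.2 < 0 then 1 else 0 else 0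

/-- The number of positive roots of type `Bₙ` which are negative on `v`. -/
def invCount (n : ℕ) (v : ℕ → ℤ) : ℤ :=
  ∑ p ∈ Finset.range n ×ˢ Finset.range n, pairInv v p +
    ∑ a ∈ Finset.range n, if v a < 0 then 1 else 0

theorem pairInv_swap (v : ℕ → ℤ) (i : ℕ) (p : ℕ × ℕ) :
    pairInv (v ∘ Equiv.swap i (i + 1)) (p.map (Equiv.swap i (i + 1)) (Equiv.swap i (i + 1))) =
      pairInv v p - (if p = (i, i + 1) then pairInv v (i, i + 1) else 0) +
        if p = (i + 1, i) then pairInv (v ∘ Equiv.swap i (i + 1)) (i, i + 1) else 0 := by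
  obtain ⟨a, b⟩ := p
  by_cases h1 : a = i ∧ b = i + 1
  · obtain ⟨rfl, rfl⟩ := h1
    simp [pairInv]
  by_cases h2 : a = i + 1 ∧ b = i
  · obtain ⟨rfl, rfl⟩ := h2
    simp [pairInv]
  have h3 : Equiv.swap i (i + 1) a < Equiv.swap i (i + 1) b ↔ a < b := by
    simp only [Equiv.swap_apply_def]
    split_ifs <;> omega
  simp [pairInv, h1, h2, h3]

theorem invCount_reflect_of_lt {n i : ℕ} (h : i + 1 < n) (v : ℕ → ℤ) :
    invCount n (reflect n i v) = invCount n v + (if v (i + 1) < v i then 1 else 0) -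
      if v i < v (i + 1) then 1 else 0 := by
  have hsw (a : ℕ) : Equiv.swap i (i + 1) a ∈ Finset.range n ↔ a ∈ Finset.range n := by
    simp only [Equiv.swap_apply_def, Finset.mem_range]
    split_ifs <;> omega
  rw [reflect, if_pos h, invCount, invCount]
  have h1 : ∑ a ∈ Finset.range n, (if (v ∘ Equiv.swap i (i + 1)) a < 0 then (1 : ℤ) else 0) =
      ∑ a ∈ Finset.range n, if v a < 0 then 1 else 0 :=
    Finset.sum_equiv (Equiv.swap i (i + 1)) (fun a => (hsw a).symm) fun a _ => rfl
  have h2 : ∑ p ∈ Finset.range n ×ˢ Finset.range n, pairInv (v ∘ Equiv.swap i (i + 1)) p =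
      ∑ p ∈ Finset.range n ×ˢ Finset.range n, pairInv (v ∘ Equiv.swap i (i + 1))
        (p.map (Equiv.swap i (i + 1)) (Equiv.swap i (i + 1))) := by
    symm
    refine Finset.sum_equiv (Equiv.prodCongr (Equiv.swap i (i + 1)) (Equiv.swap i (i + 1)))
      (fun p => ?_) fun p _ => rfl
    simp only [Finset.mem_product, Equiv.prodCongr_apply, Prod.map_fst, Prod.map_snd, hsw]
  rw [h1, h2]
  simp only [pairInv_swap, Finset.sum_add_distrib, Finset.sum_sub_distrib, Finset.sum_ite_eq',
    Finset.mem_product, Finset.mem_range, h, show i < n by omega, and_self, if_true]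
  simp only [pairInv, Function.comp, Equiv.swap_apply_left, Equiv.swap_apply_right]
  split_ifs <;> grind

theorem invCount_reflect_of_eq {n i : ℕ} (h : i + 1 = n) (v : ℕ → ℤ) :
    invCount n (reflect n i v) = invCount n v + (if 0 < v i then 1 else 0) -
      if v i < 0 then 1 else 0 := by
  subst h
  rw [reflect, if_neg (lt_irrefl _), invCount, invCount]
  have h2 : ∑ p ∈ Finset.range (i + 1) ×ˢ Finset.range (i + 1),
      pairInv (Function.update v i (-v i)) p =
      ∑ p ∈ Finset.range (i + 1) ×ˢ Finset.range (i + 1), pairInv v p := by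
    refine Finset.sum_congr rfl fun p hp => ?_
    obtain ⟨a, b⟩ := p
    simp only [Finset.mem_product, Finset.mem_range] at hp
    rcases eq_or_ne b i with rfl | hb
    · rcases eq_or_ne a b with rfl | ha
      · simp [pairInv]
      · simp only [pairInv, Function.update_self, Function.update_of_ne ha]
        split_ifs <;> omega
    · by_cases hab : a < b
      · rw [pairInv, pairInv, Function.update_of_ne hb, Function.update_of_ne (by simp; omega)]
      · simp [pairInv, hab]
  rw [h2, Finset.sum_range_succ, Finset.sum_range_succ]
  have h1 : ∑ a ∈ Finset.range i, (if Function.update v i (-v i) a < 0 then (1 : ℤ) else 0) =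
      ∑ a ∈ Finset.range i, if v a < 0 then 1 else 0 := by
    refine Finset.sum_congr rfl fun a ha => ?_
    rw [Function.update_of_ne (by simp at ha; omega)]
  rw [h1, Function.update_self]
  split_ifs <;> omega

theorem invCount_reflect_le {n i : ℕ} (h : i < n) (v : ℕ → ℤ) :
    invCount n (reflect n i v) ≤ invCount n v + 1 := by
  rcases (show i + 1 ≤ n from h).lt_or_eq with h | h
  · rw [invCount_reflect_of_lt h]
    split_ifs <;> omega
  · rw [invCount_reflect_of_eq h]
    split_ifs <;> omega

theorem reflect_apply (n i : ℕ) (v : ℕ → ℤ) (a : ℕ) :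
    reflect n i v a = if i + 1 < n then (if a = i then v (i + 1) else if a = i + 1 then v i else v a)
      else if a = i then -v i else v a := by
  unfold reflect
  split_ifs <;> simp_all [Equiv.swap_apply_def]

theorem reflect_reflect (n i : ℕ) (v : ℕ → ℤ) : reflect n i (reflect n i v) = v := by
  funext a
  simp only [reflect_apply]
  grind

theorem reflect_comm {n i j : ℕ} (h : i + 1 < j) (v : ℕ → ℤ) :
    reflect n i (reflect n j v) = reflect n j (reflect n i v) := by
  funext a
  simp only [reflect_apply]
  grind

theorem reflect_braid {n i : ℕ} (h : i + 2 < n) (v : ℕ → ℤ) :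
    reflect n i (reflect n (i + 1) (reflect n i v)) =
      reflect n (i + 1) (reflect n i (reflect n (i + 1) v)) := by
  funext a
  simp only [reflect_apply]
  grind

theorem reflect_braid_last {n i : ℕ} (h : i + 2 = n) (v : ℕ → ℤ) :
    reflect n i (reflect n (i + 1) (reflect n i (reflect n (i + 1) v))) =
      reflect n (i + 1) (reflect n i (reflect n (i + 1) (reflect n i v))) := by
  subst h
  funext a
  simp only [reflect_apply]
  grind

theorem coxeterMatrixB_apply_of_lt {n : ℕ} {i j : Fin n} (h : i < j) :
    (CoxeterMatrix.Bₙ n) i j =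
      if (i : ℕ) + 1 = j then if (j : ℕ) + 1 = n then 4 else 3 else 2 := by
  have hj := j.isLt
  have h' : (i : ℕ) < j := h
  simp only [CoxeterMatrix.Bₙ, CoxeterMatrix.B, Matrix.of_apply, h.ne, if_false]
  split_ifs <;> omega

theorem isLiftable_reflect (n : ℕ) : (CoxeterMatrix.Bₙ n).IsLiftable
    fun i => (show Function.End (ℕ → ℤ) from reflect n i) := by
  suffices h : ∀ i j : Fin n, i ≤ j → ((show Function.End (ℕ → ℤ) from reflect n i) *
      (show Function.End (ℕ → ℤ) from reflect n j)) ^ (CoxeterMatrix.Bₙ n) i j = 1 ∧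
      ((show Function.End (ℕ → ℤ) from reflect n j) *
      (show Function.End (ℕ → ℤ) from reflect n i)) ^ (CoxeterMatrix.Bₙ n) i j = 1 by
    intro i j
    rcases le_total i j with hij | hij
    · exact (h i j hij).1
    · rw [(CoxeterMatrix.Bₙ n).symmetric]
      exact (h j i hij).2
  intro i j hij
  have hj := j.isLt
  rcases (show (i : ℕ) ≤ j from hij).eq_or_lt with h | h
  · obtain rfl : i = j := Fin.ext h
    rw [CoxeterMatrix.diagonal]
    exact ⟨funext fun v => reflect_reflect n i v, funext fun v => reflect_reflect n i v⟩
  rcases (show (i : ℕ) + 1 ≤ j from h).eq_or_lt with h1 | h1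
  · rcases (show (j : ℕ) + 1 ≤ n from hj).eq_or_lt with h2 | h2
    · have hM : (CoxeterMatrix.Bₙ n) i j = 4 := by
        rw [coxeterMatrixB_apply_of_lt h]
        split_ifs
        omega
      have hb := reflect_braid_last (n := n) (i := i) (by omega)
      rw [hM]
      simp only [h1] at hb
      constructor <;> funext v
      · change reflect n i (reflect n j (reflect n i (reflect n j (reflect n i (reflect n j
          (reflect n i (reflect n j v))))))) = v
        simp only [hb, reflect_reflect]
      · change reflect n j (reflect n i (reflect n j (reflect n i (reflect n j (reflect n i
          (reflect n j (reflect n i v))))))) = v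
        simp only [← hb, reflect_reflect]
    · have hM : (CoxeterMatrix.Bₙ n) i j = 3 := by
        rw [coxeterMatrixB_apply_of_lt h]
        split_ifs <;> omega
      have hb := reflect_braid (n := n) (i := i) (by omega)
      rw [hM]
      simp only [h1] at hb
      constructor <;> funext v
      · change reflect n i (reflect n j (reflect n i (reflect n j (reflect n i (reflect n j v)))))
          = v
        simp only [hb, reflect_reflect]
      · change reflect n j (reflect n i (reflect n j (reflect n i (reflect n j (reflect n i v)))))
          = v
        simp only [← hb, reflect_reflect]
  · have hM : (CoxeterMatrix.Bₙ n) i j = 2 := by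
      rw [coxeterMatrixB_apply_of_lt h]
      split_ifs <;> omega
    have hc := reflect_comm (n := n) h1
    rw [hM]
    constructor <;> funext v
    · change reflect n i (reflect n j (reflect n i (reflect n j v))) = v
      simp only [hc, reflect_reflect]
    · change reflect n j (reflect n i (reflect n j (reflect n i v))) = v
      simp only [← hc, reflect_reflect]

end LowerBound

section TypeB

/-- The `i`-th simple reflection of the Coxeter group of type `Bₙ`, or `1` if `n ≤ i`. -/
def gen (n i : ℕ) : (CoxeterMatrix.Bₙ n).Group :=
  if h : i < n then (CoxeterMatrix.Bₙ n).toCoxeterSystem.simple ⟨i, h⟩ else 1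

theorem gen_of_lt {n i : ℕ} (h : i < n) :
    gen n i = (CoxeterMatrix.Bₙ n).toCoxeterSystem.simple ⟨i, h⟩ := dif_pos h

theorem length_gen_le (n i : ℕ) :
    (CoxeterMatrix.Bₙ n).toCoxeterSystem.length (gen n i) ≤ 1 := by
  unfold gen
  split_ifs with h
  · exact (CoxeterSystem.length_simple _ _).le
  · simp

theorem gen_mul_self (n i : ℕ) : gen n i * gen n i = 1 := by
  unfold gen
  split_ifs with h
  · exact CoxeterSystem.simple_mul_simple_self _ _
  · simp

theorem gen_mul_gen_pow {n i j m : ℕ} (hij : i < j) (hj : j < n)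
    (hm : (if i + 1 = j then if j + 1 = n then 4 else 3 else 2) = m) :
    (gen n i * gen n j) ^ m = 1 := by
  have h := (CoxeterMatrix.Bₙ n).toCoxeterSystem.simple_mul_simple_pow ⟨i, hij.trans hj⟩ ⟨j, hj⟩
  rw [coxeterMatrixB_apply_of_lt (by simpa using hij)] at h
  rwa [gen_of_lt hj, gen_of_lt (hij.trans hj), ← hm]

theorem isTypeB_gen (N : ℕ) : IsTypeB (gen (N + 1)) N where
  sq := gen_mul_self _
  comm {i j} h := by
    by_cases hj : j < N + 1
    · have hp := gen_mul_gen_pow (i := i) (m := 2) (by omega) hj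
        (by rw [if_neg (by omega)])
      rw [pow_two] at hp
      rw [eq_inv_of_mul_eq_one_left hp, mul_inv_rev, inv_eq_of_mul_eq_one_left (gen_mul_self _ _),
        inv_eq_of_mul_eq_one_left (gen_mul_self _ _)]
    · simp [gen, hj]
  braid {i} h := by
    have hp := gen_mul_gen_pow (n := N + 1) (i := i) (j := i + 1) (m := 3) (by omega) (by omega)
      (by split_ifs <;> omega)
    have hp' : gen (N + 1) i * gen (N + 1) (i + 1) * gen (N + 1) i *
        (gen (N + 1) (i + 1) * gen (N + 1) i * gen (N + 1) (i + 1)) = 1 := by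
      rw [← hp]
      simp only [pow_succ, pow_zero, one_mul, mul_assoc]
    rw [eq_inv_of_mul_eq_one_left hp']
    simp only [mul_inv_rev, inv_eq_of_mul_eq_one_left (gen_mul_self _ _), mul_assoc]
  braid_last {i} h := by
    have hp := gen_mul_gen_pow (n := N + 1) (i := i) (j := i + 1) (m := 4) (by omega) (by omega)
      (by split_ifs <;> omega)
    have hp' : gen (N + 1) i * gen (N + 1) (i + 1) * gen (N + 1) i * gen (N + 1) (i + 1) *
        (gen (N + 1) i * gen (N + 1) (i + 1) * gen (N + 1) i * gen (N + 1) (i + 1)) = 1 := by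
      rw [← hp]
      simp only [pow_succ, pow_zero, one_mul, mul_assoc]
    rw [eq_inv_of_mul_eq_one_left hp']
    simp only [mul_inv_rev, inv_eq_of_mul_eq_one_left (gen_mul_self _ _), mul_assoc]

/-- The action of the Coxeter group of type `Bₙ` on integer sequences by signed permutations. -/
noncomputable def act (n : ℕ) : (CoxeterMatrix.Bₙ n).Group →* Function.End (ℕ → ℤ) :=
  (CoxeterMatrix.Bₙ n).toCoxeterSystem.lift ⟨_, isLiftable_reflect n⟩

theorem act_simple {n : ℕ} (i : Fin n) (v : ℕ → ℤ) :
    act n ((CoxeterMatrix.Bₙ n).toCoxeterSystem.simple i) v = reflect n i v :=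
  congrFun ((CoxeterMatrix.Bₙ n).toCoxeterSystem.lift_apply_simple (isLiftable_reflect n) i) v

theorem act_gen_mul {n i : ℕ} (h : i < n) (w : (CoxeterMatrix.Bₙ n).Group) (v : ℕ → ℤ) :
    act n (gen n i * w) v = reflect n i (act n w v) := by
  rw [map_mul, gen_of_lt h]
  exact act_simple ⟨i, h⟩ _

theorem invCount_act_le (n : ℕ) (w : (CoxeterMatrix.Bₙ n).Group) (v : ℕ → ℤ) :
    invCount n (act n w v) ≤
      invCount n v + (CoxeterMatrix.Bₙ n).toCoxeterSystem.length w := by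
  obtain ⟨ω, hω, rfl⟩ := (CoxeterMatrix.Bₙ n).toCoxeterSystem.exists_isReduced w
  rw [hω.eq]
  clear hω
  induction ω with
  | nil =>
    rw [CoxeterSystem.wordProd_nil, map_one, List.length_nil, Nat.cast_zero, add_zero]
    exact le_rfl
  | cons i ω ih =>
    rw [CoxeterSystem.wordProd_cons, map_mul]
    refine (le_of_eq (congrArg _ (act_simple i _))).trans ((invCount_reflect_le i.isLt _).trans ?_)
    push_cast [List.length_cons]
    omega

/-- The integer sequence `n, n - 1, n - 2, …`. -/
def rho (n : ℕ) (a : ℕ) : ℤ := n - a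

theorem invCount_rho (n : ℕ) : invCount n (rho n) = 0 := by
  rw [invCount, Finset.sum_eq_zero, Finset.sum_eq_zero, add_zero]
  · intro a ha
    rw [Finset.mem_range] at ha
    rw [rho, if_neg (by omega)]
  · rintro ⟨a, b⟩ hp
    simp only [Finset.mem_product, Finset.mem_range] at hp
    simp only [pairInv, rho]
    split_ifs <;> omega

/-- The entry of `v` at `p` is `x`, the entries before `j` agree with `rho n` and all other entries
from `j` on are smaller than `n - j` in absolute value. -/
structure IsPeak (n j p : ℕ) (x : ℤ) (v : ℕ → ℤ) : Prop where
  apply_eq : v p = x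
  eq_rho (a : ℕ) : a < j → v a = rho n a
  abs_lt (a : ℕ) : j ≤ a → a < n → a ≠ p → |v a| < n - j

namespace IsPeak

variable {n j p : ℕ} {x : ℤ} {v : ℕ → ℤ}

theorem reflect_up (h : IsPeak n j p x v) (hj : j ≤ p) (hp : p + 1 < n) :
    IsPeak n j (p + 1) x (reflect n p v) where
  apply_eq := by simp [reflect_apply, hp, h.apply_eq]
  eq_rho a ha := by
    rw [reflect_apply, if_pos hp, if_neg (by omega), if_neg (by omega), h.eq_rho a ha]
  abs_lt a h1 h2 h3 := by
    rw [reflect_apply, if_pos hp, if_neg h3]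
    split_ifs with h4
    · exact h.abs_lt _ (by omega) hp (by omega)
    · exact h.abs_lt a h1 h2 h4

theorem reflect_down (h : IsPeak n j (p + 1) x v) (hj : j ≤ p) (hp : p + 1 < n) :
    IsPeak n j p x (reflect n p v) where
  apply_eq := by simp [reflect_apply, hp, h.apply_eq]
  eq_rho a ha := by
    rw [reflect_apply, if_pos hp, if_neg (by omega), if_neg (by omega), h.eq_rho a ha]
  abs_lt a h1 h2 h3 := by
    rw [reflect_apply, if_pos hp, if_neg h3]
    split_ifs with h4
    · exact h.abs_lt _ (by omega) (by omega) (by omega)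
    · exact h.abs_lt a h1 h2 h4

theorem reflect_last (h : IsPeak n j p x v) (hj : j ≤ p) (hp : p + 1 = n) :
    IsPeak n j p (-x) (reflect n p v) where
  apply_eq := by simp [reflect_apply, hp, h.apply_eq]
  eq_rho a ha := by
    rw [reflect_apply, if_neg (by omega), if_neg (by omega), h.eq_rho a ha]
  abs_lt a h1 h2 h3 := by
    rw [reflect_apply, if_neg (by omega), if_neg h3]
    exact h.abs_lt a h1 h2 h3

theorem abs_le (h : IsPeak n j p x v) (hx : |x| = n - j) {a : ℕ} (h1 : j ≤ a) (h2 : a < n) :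
    |v a| ≤ n - j := by
  rcases eq_or_ne a p with rfl | ha
  · rw [h.apply_eq, hx]
  · exact (h.abs_lt a h1 h2 ha).le

theorem invCount_reflect_up (h : IsPeak n j p (n - j) v) (hj : j ≤ p) (hp : p + 1 < n) :
    invCount n (reflect n p v) = invCount n v + 1 := by
  have h1 := h.apply_eq
  have h2 := _root_.abs_lt.mp (h.abs_lt (p + 1) (by omega) hp (by omega))
  rw [invCount_reflect_of_lt hp, if_pos (by omega), if_neg (by omega), sub_zero]

theorem invCount_reflect_down (h : IsPeak n j (p + 1) (-(n - j)) v) (hj : j ≤ p)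
    (hp : p + 1 < n) : invCount n (reflect n p v) = invCount n v + 1 := by
  have h1 := h.apply_eq
  have h2 := _root_.abs_lt.mp (h.abs_lt p (by omega) (by omega) (by omega))
  rw [invCount_reflect_of_lt hp, if_pos (by omega), if_neg (by omega), sub_zero]

theorem invCount_reflect_last (h : IsPeak n j p (n - j) v) (hj : j ≤ p) (hp : p + 1 = n) :
    invCount n (reflect n p v) = invCount n v + 1 := by
  have h1 := h.apply_eq
  rw [invCount_reflect_of_eq hp, if_pos (by omega), if_neg (by omega), sub_zero]

variable {l : List Bool} {w : (CoxeterMatrix.Bₙ n).Group} {u : ℕ → ℤ}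

theorem exists_mem_up (h : IsPeak n j j (n - j) (act n w u)) (hw : w ∈ listSubgroup (gen n) j l)
    {k : ℕ} (hk : k ≤ blockLen l) (hkn : j + k < n) : ∃ w' ∈ listSubgroup (gen n) j l,
      IsPeak n j (j + k) (n - j) (act n w' u) ∧
        invCount n (act n w' u) = invCount n (act n w u) + k := by
  induction k with
  | zero => exact ⟨w, hw, h, by simp⟩
  | succ k ih =>
    obtain ⟨w', hw', h1, h2⟩ := ih (by omega) (by omega)
    refine ⟨gen n (j + k) * w', mul_mem (mem_listSubgroup _ _ (getElem?_of_lt_blockLen hk)) hw', ?_⟩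
    rw [act_gen_mul (by omega)]
    refine ⟨h1.reflect_up (by omega) hkn, ?_⟩
    rw [h1.invCount_reflect_up (by omega) hkn, h2]
    push_cast
    ring

theorem exists_mem_down (h : IsPeak n j (n - 1) (-(n - j)) (act n w u))
    (hw : w ∈ listSubgroup (gen n) j l) (hl : j + blockLen l = n) {d : ℕ} (hd : j + d < n) :
    ∃ w' ∈ listSubgroup (gen n) j l, IsPeak n j (n - 1 - d) (-(n - j)) (act n w' u) ∧
        invCount n (act n w' u) = invCount n (act n w u) + d := by
  induction d with
  | zero => exact ⟨w, hw, h, by simp⟩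
  | succ d ih =>
    obtain ⟨w', hw', h1, h2⟩ := ih (by omega)
    have hm := mem_listSubgroup (gen n) j
      (getElem?_of_lt_blockLen (show n - 1 - (d + 1) - j < blockLen l by omega))
    rw [show j + (n - 1 - (d + 1) - j) = n - 1 - (d + 1) by omega] at hm
    rw [show n - 1 - d = n - 1 - (d + 1) + 1 by omega] at h1
    refine ⟨_, mul_mem hm hw', ?_⟩
    rw [act_gen_mul (by omega)]
    refine ⟨h1.reflect_down (by omega) (by omega), ?_⟩
    rw [h1.invCount_reflect_down (by omega) (by omega), h2]
    push_cast
    ring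

end IsPeak

theorem exists_invCount_eq_longestLen {n j : ℕ} {l : List Bool} (hj : j + l.length = n) :
    ∃ w ∈ listSubgroup (gen n) j l, invCount n (act n w (rho n)) = longestLen l ∧
      (∀ a < j, act n w (rho n) a = rho n a) ∧
      ∀ a, j ≤ a → a < n → |act n w (rho n) a| ≤ n - j := by
  induction l generalizing j with
  | nil =>
    refine ⟨1, one_mem _, ?_⟩
    rw [map_one]
    refine ⟨invCount_rho n, fun a _ => rfl, fun a h1 h2 => ?_⟩
    simp only [List.length_nil] at hj
    omega
  | cons b l ih =>
    rw [List.length_cons] at hj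
    obtain ⟨w, hw, h1, h2, h3⟩ := ih (show j + 1 + l.length = n by omega)
    have hpeak : IsPeak n j j (n - j) (act n w (rho n)) := by
      refine ⟨h2 j (by omega), fun a ha => h2 a (by omega), fun a ha hn hne => ?_⟩
      have := h3 a (by omega) hn
      push_cast at this
      omega
    have hx : |(n : ℤ) - j| = n - j := abs_of_nonneg (by omega)
    cases b with
    | false =>
      refine ⟨w, listSubgroup_le_cons _ _ _ _ hw, ?_, hpeak.eq_rho, fun a => hpeak.abs_le hx⟩
      rw [h1, longestLen, cosetLen_false_cons, add_zero]
    | true =>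
      have hw' := listSubgroup_le_cons (gen n) j true l hw
      have hle := blockLen_le (true :: l)
      rw [List.length_cons] at hle
      by_cases hfull : blockLen (true :: l) = (true :: l).length
      · have hfull' := hfull
        rw [List.length_cons] at hfull'
        obtain ⟨w₁, hw₁, p₁, e₁⟩ := hpeak.exists_mem_up hw' (k := l.length) (by omega) (by omega)
        rw [show j + l.length = n - 1 by omega] at p₁
        have hm := mem_listSubgroup (gen n) j
          (getElem?_of_lt_blockLen (show n - 1 - j < blockLen (true :: l) by omega))
        rw [show j + (n - 1 - j) = n - 1 by omega] at hm
        have p₂ := p₁.reflect_last (by omega) (by omega)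
        have e₂ := p₁.invCount_reflect_last (by omega) (by omega)
        rw [← act_gen_mul (by omega)] at p₂ e₂
        obtain ⟨w₃, hw₃, p₃, e₃⟩ := p₂.exists_mem_down (mul_mem hm hw₁) (by omega)
          (d := l.length) (by omega)
        refine ⟨w₃, hw₃, ?_, p₃.eq_rho, fun a => p₃.abs_le (by rw [abs_neg, hx])⟩
        rw [e₃, e₂, e₁, h1, longestLen, cosetLen, if_pos hfull]
        omega
      · have hfull' := hfull
        rw [List.length_cons] at hfull'
        obtain ⟨w₁, hw₁, p₁, e₁⟩ := hpeak.exists_mem_up hw' le_rfl (by omega)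
        refine ⟨w₁, hw₁, ?_, p₁.eq_rho, fun a => p₁.abs_le hx⟩
        rw [e₁, h1, longestLen, cosetLen, if_neg hfull]
        push_cast
        ring

theorem parabolic_eq_listSubgroup {n : ℕ} (f : Fin n → Bool) :
    parabolic (CoxeterMatrix.Bₙ n).toCoxeterSystem {i | f i = true} =
      listSubgroup (gen n) 0 (List.ofFn f) := by
  unfold parabolic listSubgroup
  congr 1
  ext g
  constructor
  · rintro ⟨i, hi, rfl⟩
    refine ⟨i, by simpa using hi, ?_⟩
    rw [zero_add, gen_of_lt i.isLt]
  · rintro ⟨i, hi, rfl⟩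
    obtain ⟨hin, hi⟩ := List.getElem?_eq_some_iff.mp hi
    rw [List.length_ofFn] at hin
    refine ⟨⟨i, hin⟩, by simpa using hi, ?_⟩
    rw [zero_add, gen_of_lt hin]

theorem length_w0 (cs : CoxeterSystem M W) {J : Set B} {L : ℕ}
    (hle : ∀ w ∈ parabolic cs J, cs.length w ≤ L) (hge : ∃ w ∈ parabolic cs J, L ≤ cs.length w) :
    cs.length (w0 cs J) = L := by
  obtain ⟨w, hw, hL⟩ := hge
  have h : ∃ w ∈ parabolic cs J, ∀ u ∈ parabolic cs J, cs.length u ≤ cs.length w :=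
    ⟨w, hw, fun u hu => (hle u hu).trans hL⟩
  rw [w0, dif_pos h]
  exact le_antisymm (hle _ h.choose_spec.1) (hL.trans (h.choose_spec.2 w hw))

theorem lenB_filter {n : ℕ} (f : Fin n → Bool) :
    lenB n {i | f i = true} = longestLen (List.ofFn f) := by
  have hcoe : ((({i | f i = true} : Finset (Fin n))) : Set (Fin n)) = {i | f i = true} := by simp
  rw [lenB, hcoe]
  apply length_w0
  · intro w hw
    rw [parabolic_eq_listSubgroup] at hw
    rcases n with _ | N
    · rw [List.ofFn_zero, listSubgroup_nil, Subgroup.mem_bot] at hw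
      simp [hw]
    · exact length_le_longestLen _ (isTypeB_gen N) (length_gen_le _) (by simp) hw
  · obtain ⟨w, hw, h, -⟩ := exists_invCount_eq_longestLen (n := n) (j := 0) (l := List.ofFn f)
      (by simp)
    refine ⟨w, by rwa [parabolic_eq_listSubgroup], ?_⟩
    have := invCount_act_le n w (rho n)
    rw [h, invCount_rho] at this
    omega

end TypeB

section GeneratingFunction

variable {R : Type*} [CommRing R] (y z : R)

/-- The weight `y^|J| z^ℓ(w0(J))` of the subset `J` described by a list. -/
def weight (l : List Bool) : R :=
  y ^ l.count true * z ^ longestLen l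

/-- The sum of the weights of all lists which consist of `k` entries `true` followed by `n`
arbitrary entries. -/
def weightSum (k n : ℕ) : R :=
  ∑ f : Fin n → Bool, weight y z (List.replicate k true ++ List.ofFn f)

theorem blockLen_replicate_append (k : ℕ) (l : List Bool) :
    blockLen (List.replicate k true ++ l) = k + blockLen l := by
  induction k with
  | zero => simp
  | succ k ih => rw [List.replicate_succ, List.cons_append, blockLen, ih]; omega

theorem longestLen_replicate (k : ℕ) : longestLen (List.replicate k true) = k ^ 2 := by
  induction k with
  | zero => simp [longestLen]
  | succ k ih =>
    have h := blockLen_replicate_append (k + 1) []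
    rw [List.append_nil, blockLen, add_zero] at h
    rw [List.replicate_succ, longestLen, ih, ← List.replicate_succ, cosetLen, h,
      List.length_replicate, if_pos rfl]
    have : (k + 1) ^ 2 = k ^ 2 + 2 * k + 1 := by ring
    omega

theorem longestLen_replicate_append_false (k : ℕ) (l : List Bool) :
    longestLen (List.replicate k true ++ false :: l) = (k + 1).choose 2 + longestLen l := by
  induction k with
  | zero => simp [longestLen, cosetLen_false_cons]
  | succ k ih =>
    have h := blockLen_replicate_append (k + 1) (false :: l)
    rw [blockLen, add_zero] at h
    rw [List.replicate_succ, List.cons_append, longestLen, ih, ← List.cons_append,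
      ← List.replicate_succ, cosetLen, h, if_neg (by simp), Nat.choose_succ_succ' (k + 1) 1,
      Nat.choose_one_right]
    ring

theorem weight_replicate (k : ℕ) : weight y z (List.replicate k true) = y ^ k * z ^ k ^ 2 := by
  rw [weight, longestLen_replicate, List.count_replicate_self]

theorem weight_replicate_append_false (k : ℕ) (l : List Bool) :
    weight y z (List.replicate k true ++ false :: l) =
      y ^ k * z ^ (k + 1).choose 2 * weight y z l := by
  rw [weight, weight, longestLen_replicate_append_false, List.count_append,
    List.count_replicate_self, List.count_cons_of_ne (by simp), pow_add, pow_add]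
  ring

theorem weightSum_zero_right (k : ℕ) : weightSum y z k 0 = y ^ k * z ^ k ^ 2 := by
  simp [weightSum, weight_replicate]

theorem weightSum_succ (k n : ℕ) :
    weightSum y z k (n + 1) =
      weightSum y z (k + 1) n + y ^ k * z ^ (k + 1).choose 2 * weightSum y z 0 n := by
  rw [weightSum, ← (Fin.consEquiv fun _ => Bool).sum_comp, Fintype.sum_prod_type,
    Fintype.sum_bool, weightSum, weightSum, Finset.mul_sum]
  congr 1
  · refine Finset.sum_congr rfl fun f _ => ?_
    simp [Fin.consEquiv, List.ofFn_succ, List.replicate_succ']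
  · refine Finset.sum_congr rfl fun f _ => ?_
    simp [Fin.consEquiv, List.ofFn_succ, weight_replicate_append_false]

theorem weightSum_add (k n : ℕ) : weightSum y z k n = y ^ (k + n) * z ^ (k + n) ^ 2 +
    ∑ i ∈ Finset.range n, y ^ (k + i) * z ^ (k + i + 1).choose 2 * weightSum y z 0 (n - 1 - i) := by
  induction n generalizing k with
  | zero => simp [weightSum_zero_right]
  | succ n ih =>
    rw [weightSum_succ, ih, Finset.sum_range_succ', add_assoc]
    congr 1
    · ring
    · congr 1
      refine Finset.sum_congr rfl fun i _ => ?_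
      rw [show k + 1 + i = k + (i + 1) by ring, show n + 1 - 1 - (i + 1) = n - 1 - i by omega]

theorem count_true_ofFn {n : ℕ} (f : Fin n → Bool) :
    (List.ofFn f).count true = Finset.card {i | f i = true} := by
  induction n with
  | zero => simp
  | succ n ih =>
    rw [List.ofFn_succ, List.count_cons, ih, Fin.card_filter_univ_succ, add_comm]
    by_cases h : f 0 = true <;> simp [h, add_comm]

theorem coeff_TB (n : ℕ) : PowerSeries.coeff n TB = weightSum yv zv 0 n := by
  classical
  have hsum : weightSum yv zv 0 n = ∑ J : Finset (Fin n), yv ^ J.card * zv ^ lenB n J := by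
    refine Fintype.sum_bijective (fun f : Fin n → Bool => ({i | f i = true} : Finset (Fin n)))
      ⟨fun f g h => ?_, fun J => ⟨fun i => decide (i ∈ J), by ext; simp⟩⟩ _ _ fun f => ?_
    · funext i
      have hi : f i = true ↔ g i = true := by simpa using Finset.ext_iff.mp h i
      exact Bool.eq_iff_iff.mpr hi
    · rw [lenB_filter, List.replicate_zero, List.nil_append, weight]
      rw [count_true_ofFn]
  set T : Finset ℕ := Finset.univ.image (lenB n) with hT
  have hB (k l : ℕ) : Bcount n k l =
      Finset.card {J : Finset (Fin n) | (J.card, lenB n J) = (k, l)} := by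
    simp only [Bcount, Nat.card_eq_fintype_card, Fintype.card_subtype, Prod.mk.injEq]
  have hB0 {k l : ℕ} (h : ¬ (k < n + 1 ∧ l ∈ T)) : Bcount n k l = 0 := by
    rw [hB, Finset.card_eq_zero, Finset.filter_eq_empty_iff]
    rintro J - hJ
    obtain ⟨rfl, rfl⟩ := Prod.mk.inj hJ
    exact h ⟨Nat.lt_succ_of_le (by simpa using J.card_le_univ),
      Finset.mem_image_of_mem _ (Finset.mem_univ J)⟩
  have hinner (k : ℕ) : ∑ᶠ l : ℕ, (Bcount n k l : Polynomial (Polynomial ℤ)) * yv ^ k * zv ^ l =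
      ∑ l ∈ T, (Bcount n k l : Polynomial (Polynomial ℤ)) * yv ^ k * zv ^ l := by
    refine finsum_eq_sum_of_support_subset _ fun l hl => ?_
    by_contra hlT
    exact hl (by simp only [hB0 fun h => hlT h.2]; simp)
  rw [TB, PowerSeries.coeff_mk, finsum_congr hinner,
    finsum_eq_sum_of_support_subset (s := Finset.range (n + 1)), hsum, ← Finset.sum_product',
    ← Finset.sum_fiberwise_of_maps_to (t := Finset.range (n + 1) ×ˢ T)
      (g := fun J => (J.card, lenB n J))]
  · refine Finset.sum_congr rfl fun p _ => ?_
    rw [hB, Finset.sum_congr rfl (g := fun _ => yv ^ p.1 * zv ^ p.2), Finset.sum_const,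
      nsmul_eq_mul, mul_assoc]
    rintro J hJ
    rw [← (Finset.mem_filter.mp hJ).2]
  · rintro J -
    rw [Finset.mem_product]
    exact ⟨Finset.mem_range.mpr (Nat.lt_succ_of_le (by simpa using J.card_le_univ)),
      Finset.mem_image_of_mem _ (Finset.mem_univ J)⟩
  · intro k hk
    by_contra hkn
    refine hk (Finset.sum_eq_zero fun l _ => ?_)
    rw [hB0 fun h => hkn (by simpa using h.1)]
    simp

end GeneratingFunction

/-- `T_B(x,y,z) · (1 - x·P) = Q`. -/
theorem TB_mul_one_sub_xP : TB * (1 - PowerSeries.X * Pser) = Qser := by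
  rw [mul_sub, mul_one, sub_eq_iff_eq_add]
  ext1 n
  rw [map_add, coeff_TB, weightSum_add, Qser, PowerSeries.coeff_mk, zero_add]
  congr 1
  rw [mul_left_comm]
  rcases n with _ | n
  · simp
  · rw [PowerSeries.coeff_succ_X_mul, mul_comm, PowerSeries.coeff_mul,
      Finset.Nat.sum_antidiagonal_eq_sum_range_succ_mk]
    refine Finset.sum_congr rfl fun i _ => ?_
    rw [coeff_TB, Pser, PowerSeries.coeff_mk, zero_add, Nat.add_sub_cancel]

end CoxeterCharPoly
end
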